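/- arXiv:1312.1882 — 2 statements merged into one kernel-verified Lean document; each statement's English description precedes it below -/
import Mathlib

section
/- Let F : ℝ → ℂ be a Schwartz function. Then lim_{t → 0⁺} t · ∑_{k∈ℤ} F(t² k²) = ∫_{−∞}^{∞} F(s²) ds. In particular, the diagonal value K_t(x, x) = ∑_{k∈ℤ} F(t² k²) of the spectral kernel of F(t²L) on the circle, L = −d²/dx², is asymptotic to c · t^{−1} as t → 0⁺, with c = ∫_{−∞}^{∞} F(s²) ds. -/
open scoped SchwartzMap

/-- The integral over `ℝ` of a function of the integer part is the sum over `ℤ`. -/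
theorem integral_comp_floor_eq_tsum {E : Type*} [NormedAddCommGroup E] [NormedSpace ℝ E]
    [CompleteSpace E] {h : ℤ → E} (hi : MeasureTheory.Integrable fun x : ℝ => h ⌊x⌋) :
    ∫ x : ℝ, h ⌊x⌋ = ∑' k : ℤ, h k := by
  have hU : ⋃ k : ℤ, Set.Ico (k : ℝ) (k + 1) = Set.univ := iUnion_Ico_intCast ℝ
  have hs := MeasureTheory.integral_iUnion (μ := MeasureTheory.volume)
    (f := fun x : ℝ => h ⌊x⌋) (s := fun k : ℤ => Set.Ico (k : ℝ) (k + 1))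
    (fun _ => measurableSet_Ico) (Set.pairwise_disjoint_Ico_intCast ℝ) hi.integrableOn
  rw [hU, MeasureTheory.setIntegral_univ] at hs
  rw [hs]
  refine tsum_congr fun k => ?_
  rw [MeasureTheory.setIntegral_congr_fun (g := fun _ => h k) measurableSet_Ico]
  · simp
  · intro x hx
    exact congrArg h (Int.floor_eq_iff.2 hx)

theorem abs_mul_floor_div_sub_le {t : ℝ} (ht : 0 < t) (s : ℝ) : |t * ⌊s / t⌋ - s| ≤ t := by
  have h₁ : ⌊s / t⌋ * t ≤ s := (le_div_iff₀ ht).1 (Int.floor_le (s / t))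
  have h₂ : s < (⌊s / t⌋ + 1) * t := (div_lt_iff₀ ht).1 (Int.lt_floor_add_one (s / t))
  rw [abs_le]
  constructor <;> linarith

/-- Riemann sums over the lattice `tℤ` of a continuous function with quadratic decay converge to
its integral as the mesh `t` tends to zero. -/
theorem tendsto_smul_tsum_int_of_quadratic_decay {E : Type*} [NormedAddCommGroup E]
    [NormedSpace ℝ E] [CompleteSpace E] {G : ℝ → E} (hG : Continuous G) {C : ℝ}
    (hC : ∀ x, ‖G x‖ ≤ C * (1 + x ^ 2)⁻¹) :
    Filter.Tendsto (fun t : ℝ => t • ∑' k : ℤ, G (t * k)) (nhdsWithin 0 (Set.Ioi 0))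
      (nhds (∫ s : ℝ, G s)) := by
  have hC0 : 0 ≤ C := by simpa using (norm_nonneg _).trans (hC 0)
  have hbound_int : MeasureTheory.Integrable fun s : ℝ => 3 * C * (1 + s ^ 2)⁻¹ :=
    integrable_inv_one_add_sq.const_mul _
  have hmeas (t : ℝ) : MeasureTheory.AEStronglyMeasurable fun s : ℝ => G (t * ⌊s / t⌋) := by
    have hm : Measurable fun s : ℝ => t * (⌊s / t⌋ : ℝ) := by fun_prop
    exact (hG.stronglyMeasurable.comp_measurable hm).aestronglyMeasurable
  have hbound {t : ℝ} (ht : t ∈ Set.Ioc (0 : ℝ) 1) (s : ℝ) :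
      ‖G (t * ⌊s / t⌋)‖ ≤ 3 * C * (1 + s ^ 2)⁻¹ := by
    have hd := abs_le.1 ((abs_mul_floor_div_sub_le ht.1 s).trans ht.2)
    set u : ℝ := t * ⌊s / t⌋
    have hu : (1 + u ^ 2)⁻¹ ≤ 3 * (1 + s ^ 2)⁻¹ := by
      rw [← div_eq_mul_inv, inv_eq_one_div, div_le_div_iff₀ (by positivity) (by positivity)]
      nlinarith [sq_nonneg (s - 2 * u), mul_nonneg (sub_nonneg.2 hd.2) 
        (neg_le_iff_add_nonneg.1 hd.1)]
    calc ‖G u‖ ≤ C * (1 + u ^ 2)⁻¹ := hC u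
      _ ≤ C * (3 * (1 + s ^ 2)⁻¹) := by gcongr
      _ = 3 * C * (1 + s ^ 2)⁻¹ := by ring
  have hsmall : ∀ᶠ t : ℝ in nhdsWithin 0 (Set.Ioi 0), t ∈ Set.Ioc (0 : ℝ) 1 :=
    Ioc_mem_nhdsGT one_pos
  have hlim : Filter.Tendsto (fun t : ℝ => ∫ s : ℝ, G (t * ⌊s / t⌋))
      (nhdsWithin 0 (Set.Ioi 0)) (nhds (∫ s : ℝ, G s)) := by
    refine MeasureTheory.tendsto_integral_filter_of_dominated_convergence _
      (.of_forall hmeas) (hsmall.mono fun t ht => .of_forall (hbound ht)) hbound_int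
      (.of_forall fun s => (hG.tendsto s).comp ?_)
    rw [tendsto_iff_dist_tendsto_zero]
    refine squeeze_zero' (.of_forall fun _ => dist_nonneg)
      (hsmall.mono fun t ht => abs_mul_floor_div_sub_le ht.1 s) ?_
    exact Filter.tendsto_id.mono_left nhdsWithin_le_nhds
  refine hlim.congr' (hsmall.mono fun t ht => ?_)
  have hstep : MeasureTheory.Integrable fun s : ℝ => G (t * ⌊s / t⌋) :=
    hbound_int.mono' (hmeas t) (.of_forall (hbound ht))
  have hfloor : MeasureTheory.Integrable fun x : ℝ => G (t * ⌊x⌋) := by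
    simpa [ht.1.ne'] using hstep.comp_mul_right' ht.1.ne'
  rw [MeasureTheory.Measure.integral_comp_div (fun x : ℝ => G (t * ⌊x⌋)) t, abs_of_pos ht.1,
    integral_comp_floor_eq_tsum (h := fun k : ℤ => G (t * k)) hfloor]

/-- On-diagonal kernel asymptotics on the circle: for a Schwartz function `F`,
`t · ∑_{k∈ℤ} F(t²k²) → ∫_{−∞}^{∞} F(s²) ds` as `t → 0⁺`.  In particular the diagonal
value `K_t(x,x) = ∑_{k∈ℤ} F(t²k²)` of the spectral kernel of `F(t²L)`, `L = −d²/dx²`,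
is asymptotic to `c · t⁻¹` with `c = ∫ F(s²) ds`. -/
theorem kernel_diagonal_asymptotics_circle (F : 𝓢(ℝ, ℂ)) :
    Filter.Tendsto (fun t : ℝ => (t : ℂ) * ∑' k : ℤ, F (t ^ 2 * (k : ℝ) ^ 2))
      (nhdsWithin 0 (Set.Ioi 0)) (nhds (∫ s : ℝ, F (s ^ 2))) := by
  obtain ⟨C₀, -, h₀⟩ := F.decay 0 0
  obtain ⟨C₁, -, h₁⟩ := F.decay 1 0
  have hdecay (x : ℝ) : ‖F (x ^ 2)‖ ≤ (C₀ + C₁) * (1 + x ^ 2)⁻¹ := by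
    have h₀x := h₀ (x ^ 2)
    have h₁x := h₁ (x ^ 2)
    simp only [norm_iteratedFDeriv_zero, pow_zero, pow_one, one_mul, Real.norm_eq_abs,
      abs_of_nonneg (sq_nonneg x)] at h₀x h₁x
    rw [← div_eq_mul_inv, le_div_iff₀ (by positivity)]
    linarith
  have hlim := tendsto_smul_tsum_int_of_quadratic_decay (G := fun x : ℝ => F (x ^ 2))
    (F.continuous.comp (continuous_pow 2)) hdecay
  simpa only [mul_pow, Complex.real_smul] using hlim
end

section
/- Let F : ℝ → ℂ be an even Schwartz function, and for t > 0 set K_t(x) = ∑_{k∈ℤ} F(t² k²) e^{ikx}. Then for every natural number N there exists a constant C(N) > 0 such that for all t ∈ (0, 1] and all x ∈ ℝ with |x| ≤ π, |K_t(x)| ≤ C(N) · t^{−1} / (max(1, |x|/t))^{N}. In other words, the kernel of F(t²L) on the circle, L = −d²/dx², is localized near the diagonal: it decays faster than any power of |x|/t away from x = 0. -/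
open scoped SchwartzMap Real FourierTransform

lemma SchwartzMap.exists_comp_sq (F : 𝓢(ℝ, ℂ)) : ∃ G : 𝓢(ℝ, ℂ), ∀ s, G s = F (s ^ 2) := by
  have hg : (fun s : ℝ ↦ s ^ 2).HasTemperateGrowth := by fun_prop
  refine ⟨SchwartzMap.compCLM ℂ hg ⟨1, 1, fun s ↦ ?_⟩ F, fun s ↦ rfl⟩
  simp only [Real.norm_eq_abs, abs_pow, sq_abs, pow_one, one_mul]
  nlinarith [sq_nonneg (|s| - 1), sq_abs s, abs_nonneg s]

lemma SchwartzMap.exists_comp_mul_left (G : 𝓢(ℝ, ℂ)) {t : ℝ} (ht : 0 < t) :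
    ∃ H : 𝓢(ℝ, ℂ), ∀ s, H s = G (t * s) :=
  ⟨SchwartzMap.compCLMOfContinuousLinearEquiv ℂ
    (ContinuousLinearEquiv.unitsEquivAut ℝ (Units.mk0 t ht.ne')) G, fun s ↦ by
      simp [mul_comm]⟩

/-- The inverse Fourier transform turns dilation by `t` into dilation by `t⁻¹`. -/
lemma Real.fourierInv_comp_mul_left (g : ℝ → ℂ) {t : ℝ} (ht : 0 < t) (y : ℝ) :
    𝓕⁻ (fun s ↦ g (t * s)) y = (t⁻¹ : ℝ) • 𝓕⁻ g (y / t) := by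
  rw [Real.fourierInv_eq', Real.fourierInv_eq']
  have h := MeasureTheory.Measure.integral_comp_mul_left
    (fun v : ℝ ↦ Complex.exp ((2 * π * inner ℝ v (y / t) : ℝ) * Complex.I) • g v) t
  rw [abs_of_pos (inv_pos.2 ht)] at h
  rw [← h]
  congr 1 with s
  congr 4
  simp only [RCLike.inner_apply, conj_trivial]
  field_simp

/-- A Schwartz function decays pointwise like `(1 + |y|) ^ (-M)`. -/
lemma SchwartzMap.exists_one_add_abs_pow_mul_norm_le (g : 𝓢(ℝ, ℂ)) (M : ℕ) :
    ∃ A : ℝ, 0 < A ∧ ∀ y, (1 + |y|) ^ M * ‖g y‖ ≤ A := by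
  have h := fun y ↦ SchwartzMap.one_add_le_sup_seminorm_apply (𝕜 := ℝ) (m := (M, 0))
    le_rfl le_rfl g y
  simp only [norm_iteratedFDeriv_zero, Real.norm_eq_abs] at h
  exact ⟨max 1 _, by positivity, fun y ↦ (h y).trans (le_max_right _ _)⟩

lemma summable_one_div_one_add_abs_int_div_two_sq :
    Summable fun n : ℤ ↦ 1 / (1 + |(n : ℝ)| / 2) ^ 2 := by
  have h := (Real.summable_abs_int_rpow one_lt_two).mul_left 4
  refine summable_of_isBigO h (Asymptotics.IsBigO.of_bound 1 ?_)
  filter_upwards [(Set.finite_singleton (0 : ℤ)).compl_mem_cofinite] with n hn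
  have hn' : 0 < |(n : ℝ)| := by simpa using hn
  rw [Real.norm_of_nonneg (by positivity), Real.norm_of_nonneg (by positivity),
    Real.rpow_neg hn'.le, one_mul, Real.rpow_two, div_le_iff₀ (by positivity)]
  field_simp
  nlinarith

lemma abs_int_div_two_le_abs_add {u : ℝ} (hu : |u| ≤ 1 / 2) (n : ℤ) :
    |(n : ℝ)| / 2 ≤ |u + n| := by
  rcases eq_or_ne n 0 with rfl | hn
  · simp
  have h1 : (1 : ℝ) ≤ |(n : ℝ)| := by exact_mod_cast Int.one_le_abs hn
  have h2 := abs_sub_abs_le_abs_sub (n : ℝ) (-u)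
  rw [abs_neg, sub_neg_eq_add, add_comm (n : ℝ)] at h2
  linarith

lemma abs_le_abs_add_int {u : ℝ} (hu : |u| ≤ 1 / 2) (n : ℤ) : |u| ≤ |u + n| := by
  rcases eq_or_ne n 0 with rfl | hn
  · simp
  have h1 : (1 : ℝ) ≤ |(n : ℝ)| := by exact_mod_cast Int.one_le_abs hn
  linarith [abs_int_div_two_le_abs_add hu n]

/-- Poisson summation for the dilates of a Schwartz function, in terms of the inverse transform. -/
lemma SchwartzMap.tsum_dilate_mul_exp (G : 𝓢(ℝ, ℂ)) {t : ℝ} (ht : 0 < t) (x : ℝ) :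
    ∑' k : ℤ, G (t * k) * Complex.exp (Complex.I * (k : ℂ) * (x : ℂ)) =
      ∑' n : ℤ, (t⁻¹ : ℝ) • (𝓕⁻ G) ((x / (2 * π) + n) / t) := by
  obtain ⟨H, hH⟩ := G.exists_comp_mul_left ht
  have hH' : (H : ℝ → ℂ) = fun s ↦ G (t * s) := funext hH
  have key := SchwartzMap.tsum_eq_tsum_fourier (𝓕⁻ H) (x / (2 * π))
  rw [FourierTransform.fourier_fourierInv_eq] at key
  have hinv : ∀ y, (𝓕⁻ H) y = (t⁻¹ : ℝ) • (𝓕⁻ G) (y / t) := fun y ↦ by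
    rw [SchwartzMap.fourierInv_coe, SchwartzMap.fourierInv_coe, hH',
      Real.fourierInv_comp_mul_left _ ht]
  simp only [hinv] at key
  rw [key]
  refine tsum_congr fun k ↦ ?_
  rw [hH, fourier_coe_apply]
  congr 2
  have : (π : ℂ) ≠ 0 := by exact_mod_cast Real.pi_ne_zero
  push_cast
  field_simp

/-- Kernel localization on the circle: for an even Schwartz function `F` and
`K_t(x) = ∑_{k∈ℤ} F(t²k²) e^{ikx}`, for every `N` there is `C(N) > 0` such that for all
`t ∈ (0,1]` and `|x| ≤ π`, `|K_t(x)| ≤ C(N) · t⁻¹ / (max(1, |x|/t))^N`; i.e. the kernel of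
`F(t²L)`, `L = −d²/dx²`, decays faster than any power of `|x|/t` away from the diagonal. -/
theorem kernel_localization_circle (F : 𝓢(ℝ, ℂ)) (hF : ∀ s : ℝ, F (-s) = F s) (N : ℕ) :
    ∃ C : ℝ, 0 < C ∧ ∀ t : ℝ, 0 < t → t ≤ 1 → ∀ x : ℝ, |x| ≤ π →
      ‖∑' k : ℤ, F (t ^ 2 * (k : ℝ) ^ 2) * Complex.exp (Complex.I * (k : ℂ) * (x : ℂ))‖ ≤
        C * t⁻¹ / (max 1 (|x| / t)) ^ N := by
  obtain ⟨G, hG⟩ := F.exists_comp_sq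
  obtain ⟨A, hA, hdecay⟩ := (𝓕⁻ G).exists_one_add_abs_pow_mul_norm_le (N + 2)
  have hS := summable_one_div_one_add_abs_int_div_two_sq
  set S := ∑' n : ℤ, 1 / (1 + |(n : ℝ)| / 2) ^ 2
  have hSpos : 0 < S := hS.tsum_pos (fun n ↦ by positivity) 0 (by positivity)
  have hpi := Real.pi_pos
  refine ⟨A * (2 * π) ^ N * S, by positivity, fun t ht ht1 x hx ↦ ?_⟩
  simp only [← mul_pow, ← hG]
  rw [G.tsum_dilate_mul_exp ht x]
  have hu : |x / (2 * π)| ≤ 1 / 2 := by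
    rw [abs_div, abs_of_pos (by positivity : 0 < 2 * π), div_le_iff₀ (by positivity)]
    linarith
  set m := max 1 (|x| / t) with hm
  have hm1 : 1 ≤ m := le_max_left _ _
  have hterm : ∀ n : ℤ, ‖(t⁻¹ : ℝ) • (𝓕⁻ G) ((x / (2 * π) + n) / t)‖ ≤
      A * (2 * π) ^ N * t⁻¹ / m ^ N * (1 / (1 + |(n : ℝ)| / 2) ^ 2) := fun n ↦ by
    set y := (x / (2 * π) + n) / t with hy
    have hyabs : |y| = |x / (2 * π) + n| / t := by rw [hy, abs_div, abs_of_pos ht]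
    have hy1 : |(n : ℝ)| / 2 ≤ |y| := by
      rw [hyabs, le_div_iff₀ ht]
      have := abs_int_div_two_le_abs_add hu n
      nlinarith [abs_nonneg (n : ℝ)]
    have hy2 : m / (2 * π) ≤ 1 + |y| := by
      rw [div_le_iff₀ (by positivity), hm]
      refine max_le (by nlinarith [Real.pi_gt_three, abs_nonneg y]) ?_
      have h := abs_le_abs_add_int hu n
      rw [abs_div, abs_of_pos (by positivity : 0 < 2 * π), div_le_iff₀ (by positivity)] at h
      have : |x| / t ≤ |y| * (2 * π) := by
        rw [hyabs, div_mul_eq_mul_div]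
        gcongr
      linarith
    have hg : (m / (2 * π)) ^ N * (1 + |(n : ℝ)| / 2) ^ 2 * ‖(𝓕⁻ G) y‖ ≤ A := by
      refine le_trans ?_ (hdecay y)
      rw [pow_add]
      gcongr
    rw [norm_smul, Real.norm_of_nonneg (inv_nonneg.2 ht.le)]
    calc t⁻¹ * ‖(𝓕⁻ G) y‖
        ≤ t⁻¹ * (A / ((m / (2 * π)) ^ N * (1 + |(n : ℝ)| / 2) ^ 2)) := by
          gcongr
          rw [le_div_iff₀ (by positivity), mul_comm]
          exact hg
      _ = _ := by
          rw [div_pow]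
          field_simp
  calc _ ≤ A * (2 * π) ^ N * t⁻¹ / m ^ N * S :=
        tsum_of_norm_bounded (hS.hasSum.mul_left _) hterm
    _ = _ := by ring
end
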